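/- Let X ~ SN₂((θ,θ), R) with θ > 0 and off-diagonal correlation ρ ∈ (-1,1). Then as x → -∞, P(X₁ ≤ x, X₂ ≤ x) ~ (α³/(πλ⁴β(1+β²)²)) √(2/π) |x|^{-3} e^{-(λ²/(2α²))(1+β²)x²}, where λ = θ(1+ρ)/√(1+θ²(1-ρ²)), α = θ(1+ρ)/√(1+2θ²(1+ρ)), β = √((1-ρ)(1+2θ²(1+ρ))/(1+ρ)). -/

import Mathlib

open Real MeasureTheory Filter Set

noncomputable def stdNormalPdf (t : ℝ) : ℝ := (Real.sqrt (2 * π))⁻¹ * Real.exp (-t ^ 2 / 2)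

noncomputable def stdNormalCdf (z : ℝ) : ℝ := ∫ t in Set.Iic z, stdNormalPdf t

noncomputable def biNormalPdf (r : ℝ) (p : ℝ × ℝ) : ℝ :=
  (2 * π * Real.sqrt (1 - r ^ 2))⁻¹ *
    Real.exp (-(p.1 ^ 2 - 2 * r * p.1 * p.2 + p.2 ^ 2) / (2 * (1 - r ^ 2)))

noncomputable def biSkewNormalPdf (θ ρ : ℝ) (p : ℝ × ℝ) : ℝ :=
  2 * biNormalPdf ρ p * stdNormalCdf (θ * p.1 + θ * p.2)

open scoped Topology

theorem stdNormalPdf_pos (t : ℝ) : 0 < stdNormalPdf t := by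
  unfold stdNormalPdf; positivity

theorem stdNormalPdf_integrable : Integrable stdNormalPdf := by
  have h := (integrable_exp_neg_mul_sq (b := 1 / 2) (by norm_num)).const_mul (Real.sqrt (2 * π))⁻¹
  refine h.congr (Eventually.of_forall fun t => ?_)
  simp only [stdNormalPdf]
  congr 2
  ring

theorem continuous_stdNormalPdf : Continuous stdNormalPdf := by
  unfold stdNormalPdf; fun_prop

theorem integrable_neg_mul_stdNormalPdf : Integrable fun t => -t * stdNormalPdf t := by
  have h := (integrable_mul_exp_neg_mul_sq (b := 1 / 2) (by norm_num)).const_mul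
    (-(Real.sqrt (2 * π))⁻¹)
  refine h.congr (Eventually.of_forall fun t => ?_)
  simp only [stdNormalPdf]
  rw [show -(1 / 2) * t ^ 2 = -t ^ 2 / 2 by ring]
  ring

theorem hasDerivAt_stdNormalPdf (t : ℝ) : HasDerivAt stdNormalPdf (-t * stdNormalPdf t) t := by
  have h : HasDerivAt (fun t : ℝ => -t ^ 2 / 2) (-t) t := by
    refine (((hasDerivAt_pow 2 t).neg).div_const 2).congr_deriv ?_
    push_cast
    ring
  refine ((h.exp).const_mul (Real.sqrt (2 * π))⁻¹).congr_deriv ?_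
  simp only [stdNormalPdf]
  ring

theorem tendsto_stdNormalPdf_atBot : Tendsto stdNormalPdf atBot (𝓝 0) := by
  have h : Tendsto (fun t : ℝ => -t ^ 2 / 2) atBot atBot := by
    have h1 : Tendsto (fun t : ℝ => t ^ 2) atBot atTop := by
      have := (tendsto_pow_atTop (α := ℝ) two_ne_zero).comp tendsto_neg_atBot_atTop
      refine this.congr fun t => ?_
      simp
    have := (tendsto_neg_atTop_atBot.comp h1).atBot_div_const (show (0 : ℝ) < 2 by norm_num)
    exact this
  have h2 := (Real.tendsto_exp_atBot.comp h).const_mul (Real.sqrt (2 * π))⁻¹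
  rwa [mul_zero] at h2

theorem stdNormalCdf_nonneg (z : ℝ) : 0 ≤ stdNormalCdf z :=
  setIntegral_nonneg measurableSet_Iic fun t _ => (stdNormalPdf_pos t).le

theorem monotone_stdNormalCdf : Monotone stdNormalCdf := fun _ _ hab =>
  setIntegral_mono_set stdNormalPdf_integrable.integrableOn
    (Eventually.of_forall fun t => (stdNormalPdf_pos t).le) (Iic_subset_Iic.2 hab).eventuallyLE

theorem neg_mul_stdNormalCdf_le (z : ℝ) :
    -z * stdNormalCdf z ≤ stdNormalPdf z := by
  have h1 : ∫ t in Iic z, -t * stdNormalPdf t = stdNormalPdf z - 0 :=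
    integral_Iic_of_hasDerivAt_of_tendsto' (fun t _ => hasDerivAt_stdNormalPdf t)
      integrable_neg_mul_stdNormalPdf.integrableOn tendsto_stdNormalPdf_atBot
  rw [sub_zero] at h1
  rw [← h1, stdNormalCdf, ← integral_const_mul]
  refine setIntegral_mono_on (stdNormalPdf_integrable.const_mul _).integrableOn
    integrable_neg_mul_stdNormalPdf.integrableOn measurableSet_Iic fun t ht => ?_
  have := (stdNormalPdf_pos t).le
  have ht : t ≤ z := ht
  gcongr

theorem stdNormalPdf_le_mul_stdNormalCdf {z : ℝ} (hz : z < 0) :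
    stdNormalPdf z ≤ -z * (1 + (z ^ 2)⁻¹) * stdNormalCdf z := by
  have hbd : ∀ t ∈ Iic z, stdNormalPdf t * (1 + (t ^ 2)⁻¹) ≤ (1 + (z ^ 2)⁻¹) * stdNormalPdf t := by
    intro t ht
    have ht : t ≤ z := ht
    have h2 : z ^ 2 ≤ t ^ 2 := by nlinarith
    have h3 : 0 < z ^ 2 := by nlinarith
    have := (stdNormalPdf_pos t).le
    rw [mul_comm]
    gcongr
  have hint : IntegrableOn (fun t => stdNormalPdf t * (1 + (t ^ 2)⁻¹)) (Iic z) := by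
    refine Integrable.mono' ((stdNormalPdf_integrable.const_mul (1 + (z ^ 2)⁻¹)).integrableOn) ?_ ?_
    · have := continuous_stdNormalPdf.measurable
      exact Measurable.aestronglyMeasurable (by fun_prop)
    · refine (ae_restrict_iff' measurableSet_Iic).2 (Eventually.of_forall fun t ht => ?_)
      have := stdNormalPdf_pos t
      rw [Real.norm_of_nonneg (by positivity)]
      exact hbd t ht
  have hd : ∀ t ∈ Iic z, HasDerivAt (fun t => stdNormalPdf t * (-t)⁻¹)
      (stdNormalPdf t * (1 + (t ^ 2)⁻¹)) t := by
    intro t ht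
    have ht0 : t ≠ 0 := (lt_of_le_of_lt ht hz).ne
    have := (hasDerivAt_stdNormalPdf t).mul ((hasDerivAt_neg t).inv (neg_ne_zero.2 ht0))
    refine this.congr_deriv ?_
    simp only [Pi.inv_apply, neg_neg, neg_sq]
    field_simp
  have hlim : Tendsto (fun t => stdNormalPdf t * (-t)⁻¹) atBot (𝓝 0) := by
    simpa using tendsto_stdNormalPdf_atBot.mul
      (tendsto_inv_atTop_zero.comp tendsto_neg_atBot_atTop)
  have h1 := integral_Iic_of_hasDerivAt_of_tendsto' hd hint hlim
  have h2 : ∫ t in Iic z, stdNormalPdf t * (1 + (t ^ 2)⁻¹)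
      ≤ (1 + (z ^ 2)⁻¹) * stdNormalCdf z := by
    rw [stdNormalCdf, ← integral_const_mul]
    exact setIntegral_mono_on hint (stdNormalPdf_integrable.const_mul _).integrableOn
      measurableSet_Iic hbd
  rw [h1, sub_zero, ← div_eq_mul_inv, div_le_iff₀ (by linarith)] at h2
  linarith

/-- Mills' ratio asymptotics in the lower tail. -/
theorem tendsto_neg_mul_stdNormalCdf_div :
    Tendsto (fun z => -z * (stdNormalCdf z / stdNormalPdf z)) atBot (𝓝 1) := by
  have hlow : Tendsto (fun z : ℝ => (1 + (z ^ 2)⁻¹)⁻¹) atBot (𝓝 1) := by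
    have h1 : Tendsto (fun z : ℝ => z⁻¹ ^ 2) atBot (𝓝 (0 ^ 2)) := tendsto_inv_atBot_zero.pow 2
    have h2 := (h1.const_add 1).inv₀ (by norm_num)
    simpa using h2
  refine tendsto_of_tendsto_of_tendsto_of_le_of_le' hlow tendsto_const_nhds ?_ ?_
  · filter_upwards [eventually_lt_atBot 0] with z hz
    have h := stdNormalPdf_le_mul_stdNormalCdf hz
    have hp := stdNormalPdf_pos z
    rw [inv_le_iff_one_le_mul₀ (by positivity), ← mul_div_assoc, div_mul_eq_mul_div,
      le_div_iff₀ hp]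
    linarith
  · refine Eventually.of_forall fun z => ?_
    rw [← mul_div_assoc, div_le_one (stdNormalPdf_pos z)]
    exact neg_mul_stdNormalCdf_le z

/-- The density in coordinates centred at `(x, x)` and rescaled by `x⁻¹`. -/
theorem biSkewNormalPdf_rescaled (θ ρ : ℝ) (hρ : -1 < ρ) (hρ' : ρ < 1) {x : ℝ} (hx : x ≠ 0)
    (w : ℝ × ℝ) :
    biSkewNormalPdf θ ρ (x + x⁻¹ * w.1, x + x⁻¹ * w.2) =
      (π * Real.sqrt (1 - ρ ^ 2) * Real.sqrt (2 * π))⁻¹ *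
        Real.exp (-((1 + 2 * θ ^ 2 * (1 + ρ)) / (1 + ρ)) * x ^ 2) *
        (Real.exp (-((1 + 2 * θ ^ 2 * (1 + ρ)) / (1 + ρ)) * w.1) *
          Real.exp (-((1 + 2 * θ ^ 2 * (1 + ρ)) / (1 + ρ)) * w.2)) *
        Real.exp (-((w.1 ^ 2 - 2 * ρ * w.1 * w.2 + w.2 ^ 2) / (2 * (1 - ρ ^ 2))
          + θ ^ 2 * (w.1 + w.2) ^ 2 / 2) * x⁻¹ ^ 2) *
        (stdNormalCdf (θ * (2 * x + x⁻¹ * (w.1 + w.2))) /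
          stdNormalPdf (θ * (2 * x + x⁻¹ * (w.1 + w.2)))) := by
  obtain ⟨u, v⟩ := w
  have hz : θ * (x + x⁻¹ * u) + θ * (x + x⁻¹ * v) = θ * (2 * x + x⁻¹ * (u + v)) := by ring
  set z := θ * (2 * x + x⁻¹ * (u + v)) with hzdef
  have hP : stdNormalCdf z = (Real.sqrt (2 * π))⁻¹ * Real.exp (-z ^ 2 / 2) *
      (stdNormalCdf z / stdNormalPdf z) := by
    change _ = stdNormalPdf z * _
    rw [mul_div_cancel₀]
    exact (stdNormalPdf_pos z).ne'
  have hexp : -((x + x⁻¹ * u) ^ 2 - 2 * ρ * (x + x⁻¹ * u) * (x + x⁻¹ * v) + (x + x⁻¹ * v) ^ 2) /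
        (2 * (1 - ρ ^ 2)) + -z ^ 2 / 2 =
      -((1 + 2 * θ ^ 2 * (1 + ρ)) / (1 + ρ)) * x ^ 2 +
      (-((1 + 2 * θ ^ 2 * (1 + ρ)) / (1 + ρ)) * u + -((1 + 2 * θ ^ 2 * (1 + ρ)) / (1 + ρ)) * v) +
      -((u ^ 2 - 2 * ρ * u * v + v ^ 2) / (2 * (1 - ρ ^ 2))
          + θ ^ 2 * (u + v) ^ 2 / 2) * x⁻¹ ^ 2 := by
    have h1 : 1 + ρ ≠ 0 := by linarith
    have h2 : 1 - ρ ≠ 0 := by linarith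
    have h3 : 1 - ρ ^ 2 = (1 + ρ) * (1 - ρ) := by ring
    rw [hzdef, h3]
    field_simp
    ring
  have hexp' := congrArg Real.exp hexp
  simp only [Real.exp_add] at hexp'
  simp only [biSkewNormalPdf, biNormalPdf]
  rw [hz]
  nth_rewrite 1 [hP]
  simp only [mul_inv]
  linear_combination (π⁻¹ * (Real.sqrt (1 - ρ ^ 2))⁻¹ * (Real.sqrt (2 * π))⁻¹ *
    (stdNormalCdf z / stdNormalPdf z)) * hexp'

theorem setIntegral_lower_quadrant_rescale (f : ℝ × ℝ → ℝ) {x : ℝ} (hx : x < 0) :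
    ∫ p in {p : ℝ × ℝ | p.1 ≤ x ∧ p.2 ≤ x}, f p =
      (x ^ 2)⁻¹ * ∫ w in Ici (0 : ℝ) ×ˢ Ici (0 : ℝ), f (x + x⁻¹ * w.1, x + x⁻¹ * w.2) := by
  have hS : MeasurableSet {p : ℝ × ℝ | p.1 ≤ x ∧ p.2 ≤ x} :=
    (measurableSet_le measurable_fst measurable_const).inter
      (measurableSet_le measurable_snd measurable_const)
  have hQ : MeasurableSet (Ici (0 : ℝ) ×ˢ Ici (0 : ℝ)) := measurableSet_Ici.prod measurableSet_Ici
  rw [← integral_indicator hS, ← integral_indicator hQ]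
  set g := ({p : ℝ × ℝ | p.1 ≤ x ∧ p.2 ≤ x}).indicator f with hg
  have h1 : ∫ p, g ((x, x) + p) = ∫ p, g p := integral_add_left_eq_self g (x, x)
  have h2 := Measure.integral_comp_smul (volume : Measure (ℝ × ℝ)) (fun p => g ((x, x) + p)) x⁻¹
  rw [h1] at h2
  have hfr : Module.finrank ℝ (ℝ × ℝ) = 2 := by simp
  rw [hfr, inv_pow, inv_inv, abs_of_nonneg (sq_nonneg x), smul_eq_mul] at h2
  have h3 : ∀ w : ℝ × ℝ, g ((x, x) + x⁻¹ • w) = (Ici (0 : ℝ) ×ˢ Ici (0 : ℝ)).indicator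
      (fun w => f (x + x⁻¹ * w.1, x + x⁻¹ * w.2)) w := by
    intro w
    have hi : x⁻¹ < 0 := inv_lt_zero.2 hx
    have key : ∀ u : ℝ, x + x⁻¹ * u ≤ x ↔ 0 ≤ u := fun u =>
      ⟨fun h => by by_contra hu; nlinarith [mul_pos_of_neg_of_neg hi (not_le.1 hu)],
        fun h => by nlinarith⟩
    simp only [hg, indicator, mem_ofPred_eq, mem_prod, mem_Ici, Prod.fst_add, Prod.snd_add,
      Prod.smul_fst, Prod.smul_snd, smul_eq_mul, key]
    rfl
  simp only [h3] at h2
  rw [h2, ← mul_assoc, inv_mul_cancel₀ (pow_ne_zero 2 hx.ne), one_mul]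

theorem mills_rescaled_le {θ x s : ℝ} (hθ : 0 < θ) (hx : x < 0) (hs : 0 ≤ s) :
    -x * (stdNormalCdf (θ * (2 * x + x⁻¹ * s)) / stdNormalPdf (θ * (2 * x + x⁻¹ * s)))
      ≤ (2 * θ)⁻¹ := by
  have hi : x⁻¹ * s ≤ 0 := mul_nonpos_of_nonpos_of_nonneg (inv_lt_zero.2 hx).le hs
  have hz : θ * (2 * x + x⁻¹ * s) ≤ 2 * θ * x := by nlinarith
  set z := θ * (2 * x + x⁻¹ * s)
  have h := neg_mul_stdNormalCdf_le z
  have hp := stdNormalPdf_pos z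
  have hc := stdNormalCdf_nonneg z
  rw [← mul_div_assoc, div_le_iff₀ hp, inv_mul_eq_div, le_div_iff₀ (by positivity)]
  nlinarith

theorem tendsto_mills_rescaled {θ s : ℝ} (hθ : 0 < θ) (hs : 0 ≤ s) :
    Tendsto (fun x => -x * (stdNormalCdf (θ * (2 * x + x⁻¹ * s)) /
      stdNormalPdf (θ * (2 * x + x⁻¹ * s)))) atBot (𝓝 (2 * θ)⁻¹) := by
  have hz : Tendsto (fun x : ℝ => θ * (2 * x + x⁻¹ * s)) atBot atBot := by
    refine tendsto_atBot_mono' _ ?_ (tendsto_id.const_mul_atBot (show 0 < 2 * θ by positivity))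
    filter_upwards [eventually_lt_atBot 0] with x hx
    have hi : x⁻¹ * s ≤ 0 := mul_nonpos_of_nonpos_of_nonneg (inv_lt_zero.2 hx).le hs
    simp only [id]
    nlinarith
  have h1 : Tendsto (fun x : ℝ => (θ * (2 + x⁻¹ * x⁻¹ * s))⁻¹) atBot (𝓝 (2 * θ)⁻¹) := by
    have h := ((((tendsto_inv_atBot_zero (𝕜 := ℝ)).mul tendsto_inv_atBot_zero).mul_const
      s).const_add 2).const_mul θ
    have h' := h.inv₀ (by simpa using hθ.ne')
    simpa [mul_comm] using h'
  have h2 := h1.mul (tendsto_neg_mul_stdNormalCdf_div.comp hz)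
  rw [mul_one] at h2
  refine h2.congr' ?_
  filter_upwards [eventually_lt_atBot 0] with x hx
  have h0 : (2 + x⁻¹ * x⁻¹ * s) ≠ 0 := by
    have := mul_self_nonneg x⁻¹
    positivity
  have hx' := hx.ne
  simp only [Function.comp]
  rw [← mul_assoc]
  congr 1
  rw [show -(θ * (2 * x + x⁻¹ * s)) = (θ * (2 + x⁻¹ * x⁻¹ * s)) * -x by field_simp]
  rw [inv_mul_cancel_left₀ (mul_ne_zero hθ.ne' h0)]

theorem biNormal_quadratic_nonneg {ρ : ℝ} (hρ : -1 < ρ) (hρ' : ρ < 1) (u v : ℝ) :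
    0 ≤ (u ^ 2 - 2 * ρ * u * v + v ^ 2) / (2 * (1 - ρ ^ 2)) := by
  have h1 : 0 < 1 - ρ ^ 2 := by nlinarith
  refine div_nonneg ?_ (by positivity)
  nlinarith [sq_nonneg (u - ρ * v), sq_nonneg v]

theorem tendsto_cube_mul_exp_mul_joint_tail {θ ρ : ℝ} (hθ : 0 < θ) (hρ : -1 < ρ) (hρ' : ρ < 1)
    {k : ℝ} (hk : k = (1 + 2 * θ ^ 2 * (1 + ρ)) / (1 + ρ)) :
    Tendsto (fun x : ℝ => |x| ^ 3 * Real.exp (k * x ^ 2) *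
      ∫ p in {p : ℝ × ℝ | p.1 ≤ x ∧ p.2 ≤ x}, biSkewNormalPdf θ ρ p) atBot
      (𝓝 ((π * Real.sqrt (1 - ρ ^ 2) * Real.sqrt (2 * π))⁻¹ * ((k ^ 2)⁻¹ * (2 * θ)⁻¹))) := by
  have hk0 : 0 < k := by
    have : 0 < 1 + ρ := by linarith
    rw [hk]; positivity
  set Q := Ici (0 : ℝ) ×ˢ Ici (0 : ℝ) with hQdef
  have hQ : MeasurableSet Q := measurableSet_Ici.prod measurableSet_Ici
  set F : ℝ → ℝ × ℝ → ℝ := fun x w =>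
    (Real.exp (-k * w.1) * Real.exp (-k * w.2)) *
      (Real.exp (-((w.1 ^ 2 - 2 * ρ * w.1 * w.2 + w.2 ^ 2) / (2 * (1 - ρ ^ 2))
          + θ ^ 2 * (w.1 + w.2) ^ 2 / 2) * x⁻¹ ^ 2) *
        (-x * (stdNormalCdf (θ * (2 * x + x⁻¹ * (w.1 + w.2))) /
          stdNormalPdf (θ * (2 * x + x⁻¹ * (w.1 + w.2)))))) with hF
  have hexpI : IntegrableOn (fun u : ℝ => Real.exp (-k * u)) (Ici 0) :=
    (integrableOn_Ici_iff_integrableOn_Ioi (by simp)).2 (integrableOn_exp_mul_Ioi (neg_lt_zero.2 hk0) 0)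
  have hexp2 : IntegrableOn (fun w : ℝ × ℝ => Real.exp (-k * w.1) * Real.exp (-k * w.2)) Q := by
    have h := Integrable.mul_prod hexpI hexpI
    rwa [Measure.prod_restrict, ← Measure.volume_eq_prod] at h
  have hlimI : ∫ w in Q, Real.exp (-k * w.1) * Real.exp (-k * w.2) * (1 * (2 * θ)⁻¹) =
      (k ^ 2)⁻¹ * (2 * θ)⁻¹ := by
    rw [integral_mul_const, Measure.volume_eq_prod, hQdef,
      setIntegral_prod_mul (fun u => Real.exp (-k * u)) (fun u => Real.exp (-k * u)),
      integral_Ici_eq_integral_Ioi, integral_exp_mul_Ioi (neg_lt_zero.2 hk0)]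
    simp only [mul_zero, Real.exp_zero, one_mul]
    field_simp
  have hmeas : ∀ x, Measurable (F x) := by
    intro x
    have h1 := monotone_stdNormalCdf.measurable
    have h2 := continuous_stdNormalPdf.measurable
    simp only [hF]
    fun_prop
  have hDCT : Tendsto (fun x => ∫ w in Q, F x w) atBot (𝓝 ((k ^ 2)⁻¹ * (2 * θ)⁻¹)) := by
    rw [← hlimI]
    refine tendsto_integral_filter_of_dominated_convergence
      (fun w => Real.exp (-k * w.1) * Real.exp (-k * w.2) * (1 * (2 * θ)⁻¹))
      (Eventually.of_forall fun x => (hmeas x).aestronglyMeasurable) ?_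
      (hexp2.mul_const _) ?_
    · filter_upwards [eventually_lt_atBot 0] with x hx
      refine (ae_restrict_iff' hQ).2 (Eventually.of_forall fun w hw => ?_)
      have hs : 0 ≤ w.1 + w.2 := add_nonneg hw.1 hw.2
      have hM := mills_rescaled_le hθ hx hs
      have hM0 : 0 ≤ -x * (stdNormalCdf (θ * (2 * x + x⁻¹ * (w.1 + w.2))) /
          stdNormalPdf (θ * (2 * x + x⁻¹ * (w.1 + w.2)))) :=
        mul_nonneg (by linarith) (div_nonneg (stdNormalCdf_nonneg _) (stdNormalPdf_pos _).le)
      have hq := biNormal_quadratic_nonneg hρ hρ' w.1 w.2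
      rw [Real.norm_of_nonneg (by simp only [hF]; positivity)]
      simp only [hF]
      gcongr
      rw [Real.exp_le_one_iff, neg_mul]
      exact neg_nonpos.2 (by positivity)
    · refine (ae_restrict_iff' hQ).2 (Eventually.of_forall fun w hw => ?_)
      have hs : 0 ≤ w.1 + w.2 := add_nonneg hw.1 hw.2
      refine Tendsto.const_mul _ (Tendsto.mul ?_ (tendsto_mills_rescaled hθ hs))
      have h := ((tendsto_inv_atBot_zero (𝕜 := ℝ)).pow 2).const_mul
        (-((w.1 ^ 2 - 2 * ρ * w.1 * w.2 + w.2 ^ 2) / (2 * (1 - ρ ^ 2))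
          + θ ^ 2 * (w.1 + w.2) ^ 2 / 2))
      have h' := (Real.continuous_exp.tendsto _).comp h
      simpa using! h'
  refine (hDCT.const_mul _).congr' ?_
  filter_upwards [eventually_lt_atBot 0] with x hx
  rw [setIntegral_lower_quadrant_rescale _ hx]
  simp only [biSkewNormalPdf_rescaled θ ρ hρ hρ' hx.ne, ← hk]
  rw [← mul_assoc, ← integral_const_mul, ← integral_const_mul]
  congr 1
  ext w
  simp only [hF]
  have hE : Real.exp (k * x ^ 2) * Real.exp (-k * x ^ 2) = 1 := by
    rw [← Real.exp_add, neg_mul, add_neg_cancel, Real.exp_zero]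
  have hX : |x| ^ 3 * (x ^ 2)⁻¹ = -x := by
    have := hx.ne
    rw [abs_of_neg hx]
    field_simp
  generalize stdNormalCdf _ / stdNormalPdf _ = M
  rw [← hX, ← one_mul (_ * _ : ℝ), ← hE]
  ring

/-- Joint lower tail asymptotics of the equi-skew bivariate skew normal, θ > 0:
P(X₁ ≤ x, X₂ ≤ x) ~ (α³/(πλ⁴β(1+β²)²)) √(2/π) |x|⁻³ e^{-(λ²/(2α²))(1+β²)x²}
as x → -∞. -/
theorem biSkewNormal_joint_tail_pos (θ ρ : ℝ) (hθ : 0 < θ) (hρ : -1 < ρ) (hρ' : ρ < 1)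
    (l α β : ℝ)
    (hl : l = θ * (1 + ρ) / Real.sqrt (1 + θ ^ 2 * (1 - ρ ^ 2)))
    (hα : α = θ * (1 + ρ) / Real.sqrt (1 + 2 * θ ^ 2 * (1 + ρ)))
    (hβ : β = Real.sqrt ((1 - ρ) * (1 + 2 * θ ^ 2 * (1 + ρ)) / (1 + ρ))) :
    Tendsto (fun x : ℝ =>
      (∫ p in {p : ℝ × ℝ | p.1 ≤ x ∧ p.2 ≤ x}, biSkewNormalPdf θ ρ p) /
      ((α ^ 3 / (π * l ^ 4 * β * (1 + β ^ 2) ^ 2)) * Real.sqrt (2 / π) *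
        |x| ^ (-3 : ℤ) * Real.exp (-(l ^ 2 / (2 * α ^ 2)) * (1 + β ^ 2) * x ^ 2)))
      atBot (nhds 1) := by
  have hr : 0 < 1 + ρ := by linarith
  have hr' : 0 < 1 - ρ := by linarith
  set A := 1 + 2 * θ ^ 2 * (1 + ρ) with hA
  set B := 1 + θ ^ 2 * (1 - ρ ^ 2) with hB
  have hρ2 : 1 - ρ ^ 2 = (1 - ρ) * (1 + ρ) := by ring
  have hA0 : 0 < A := by positivity
  have hB0 : 0 < B := by rw [hB, hρ2]; positivity
  have hsA := Real.sq_sqrt hA0.le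
  have hsB := Real.sq_sqrt hB0.le
  have hsr := Real.sq_sqrt hr.le
  have hβ' : β = Real.sqrt (1 - ρ) * Real.sqrt A / Real.sqrt (1 + ρ) := by
    rw [hβ, Real.sqrt_div (by positivity), Real.sqrt_mul hr'.le]
  have hβ2 : 1 + β ^ 2 = 2 * B / (1 + ρ) := by
    rw [hβ, Real.sq_sqrt (by positivity), hA, hB]
    field_simp
    ring
  have hl2 : l ^ 2 = θ ^ 2 * (1 + ρ) ^ 2 / B := by rw [hl, div_pow, hsB]; ring
  have hα2 : α ^ 2 = θ ^ 2 * (1 + ρ) ^ 2 / A := by rw [hα, div_pow, hsA]; ring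
  have hk : l ^ 2 / (2 * α ^ 2) * (1 + β ^ 2) = A / (1 + ρ) := by
    rw [hl2, hα2, hβ2]
    field_simp
  have hC : α ^ 3 / (π * l ^ 4 * β * (1 + β ^ 2) ^ 2) * Real.sqrt (2 / π) =
      (π * Real.sqrt (1 - ρ ^ 2) * Real.sqrt (2 * π))⁻¹ *
        (((A / (1 + ρ)) ^ 2)⁻¹ * (2 * θ)⁻¹) := by
    rw [show l ^ 4 = (l ^ 2) ^ 2 by ring, show α ^ 3 = α ^ 2 * α by ring, hl2, hα2, hβ2, hβ', hα,
      hρ2, Real.sqrt_mul hr'.le, Real.sqrt_div zero_le_two, Real.sqrt_mul zero_le_two]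
    have hs2 := Real.sq_sqrt (zero_le_two (α := ℝ))
    have h1 : Real.sqrt (1 - ρ) ≠ 0 := by positivity
    have h2 : Real.sqrt (1 + ρ) ≠ 0 := by positivity
    have h3 : Real.sqrt A ≠ 0 := by positivity
    field_simp
    simp only [hsA, hsr, hs2]
    ring
  set c := (π * Real.sqrt (1 - ρ ^ 2) * Real.sqrt (2 * π))⁻¹ *
    (((A / (1 + ρ)) ^ 2)⁻¹ * (2 * θ)⁻¹) with hc
  have hc0 : c ≠ 0 := by
    have : 0 < 1 - ρ ^ 2 := by rw [hρ2]; positivity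
    positivity
  have hT := (tendsto_cube_mul_exp_mul_joint_tail hθ hρ hρ' (k := A / (1 + ρ)) rfl).div_const c
  rw [← hc, div_self hc0] at hT
  refine hT.congr' ?_
  filter_upwards [eventually_lt_atBot 0] with x hx
  have hx0 : |x| ≠ 0 := abs_ne_zero.2 hx.ne
  have he := (Real.exp_pos (A / (1 + ρ) * x ^ 2)).ne'
  rw [hC, neg_mul, hk, neg_mul, Real.exp_neg, zpow_neg, zpow_ofNat]
  field_simp
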